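/- arXiv:math/9901020 — 6 statements merged into one kernel-verified Lean document; each statement's English description precedes it below -/
import Mathlib

section
/- Each of the operators R̂^+ and R̂^- satisfies the (braid form of the) Yang–Baxter equation on ℂ²⊗ℂ²⊗ℂ²: (R̂^± ⊗ id)(id ⊗ R̂^±)(R̂^± ⊗ id) = (id ⊗ R̂^±)(R̂^± ⊗ id)(id ⊗ R̂^±). -/
/- The R-matrices `R^{±αβ}_{γδ} = δ^α_γ δ^β_δ + a^{±1} ε^{αβ} ε_{γδ}` built from a
spinor metric `ε` (matrices `εu = ε^{··}` and `εd = ε_{··}` mutually inverse). -/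
def RmatA (εu εd : Matrix (Fin 2) (Fin 2) ℂ) (c : ℂ) (α β γ δ : Fin 2) : ℂ :=
  (if α = γ then 1 else 0) * (if β = δ then 1 else 0) + c * εu α β * εd γ δ

/-- The operator `R̂` on `ℂ²⊗ℂ²` (sending `e_γ⊗e_δ` to `Σ R^{αβ}_{γδ} e_α⊗e_β`),
as a matrix indexed by pairs. -/
def Rhat (εu εd : Matrix (Fin 2) (Fin 2) ℂ) (c : ℂ) :
    Matrix (Fin 2 × Fin 2) (Fin 2 × Fin 2) ℂ :=
  fun p q => RmatA εu εd c p.1 p.2 q.1 q.2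

/-- `R̂ ⊗ id` on `ℂ²⊗ℂ²⊗ℂ²`. -/
def R12 (R : Matrix (Fin 2 × Fin 2) (Fin 2 × Fin 2) ℂ) :
    Matrix (Fin 2 × Fin 2 × Fin 2) (Fin 2 × Fin 2 × Fin 2) ℂ :=
  fun p q => R (p.1, p.2.1) (q.1, q.2.1) * (if p.2.2 = q.2.2 then 1 else 0)

/-- `id ⊗ R̂` on `ℂ²⊗ℂ²⊗ℂ²`. -/
def R23 (R : Matrix (Fin 2 × Fin 2) (Fin 2 × Fin 2) ℂ) :
    Matrix (Fin 2 × Fin 2 × Fin 2) (Fin 2 × Fin 2 × Fin 2) ℂ :=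
  fun p q => (if p.1 = q.1 then 1 else 0) * R (p.2.1, p.2.2) (q.2.1, q.2.2)

/-- If `x` and `y` satisfy the Temperley–Lieb relations with loop value `t` and
`1 + c t + c² = 0`, then `1 + c x` and `1 + c y` satisfy the braid relation. -/
theorem braid_of_temperleyLieb {A : Type*} [Ring A] [Algebra ℂ A] {x y : A} {c t : ℂ}
    (hx : x * x = t • x) (hy : y * y = t • y) (hxy : x * y * x = x) (hyx : y * x * y = y)
    (hc : 1 + c * t + c * c = 0) :
    (1 + c • x) * (1 + c • y) * (1 + c • x) = (1 + c • y) * (1 + c • x) * (1 + c • y) := by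
  have key (u v : A) (hu : u * u = t • u) (huv : u * v * u = u) :
      (1 + c • u) * (1 + c • v) * (1 + c • u) =
        1 + c • u + c • v + (c * c) • (u * v + v * u) + (c * (1 + c * t + c * c)) • u := by
    simp only [mul_add, add_mul, one_mul, mul_one, smul_mul_assoc, mul_smul_comm, hu, huv]
    module
  rw [key x y hx hxy, key y x hy hyx, hc]
  module

/-- The rank-one operator `ε^{αβ} ε_{γδ}` on `ℂ²⊗ℂ²`. -/
def cupCap (εu εd : Matrix (Fin 2) (Fin 2) ℂ) :
    Matrix (Fin 2 × Fin 2) (Fin 2 × Fin 2) ℂ :=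
  fun p q => εu p.1 p.2 * εd q.1 q.2

theorem R12_Rhat (εu εd : Matrix (Fin 2) (Fin 2) ℂ) (c : ℂ) :
    R12 (Rhat εu εd c) = 1 + c • R12 (cupCap εu εd) := by
  ext ⟨i, j, k⟩ ⟨l, m, n⟩
  simp only [R12, Rhat, RmatA, cupCap, Matrix.add_apply, Matrix.smul_apply, Matrix.one_apply,
    Prod.mk.injEq, smul_eq_mul, ite_and]
  split_ifs <;> ring

theorem R23_Rhat (εu εd : Matrix (Fin 2) (Fin 2) ℂ) (c : ℂ) :
    R23 (Rhat εu εd c) = 1 + c • R23 (cupCap εu εd) := by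
  ext ⟨i, j, k⟩ ⟨l, m, n⟩
  simp only [R23, Rhat, RmatA, cupCap, Matrix.add_apply, Matrix.smul_apply, Matrix.one_apply,
    Prod.mk.injEq, smul_eq_mul, ite_and]
  split_ifs <;> ring

theorem R12_cupCap_mul_self (εu εd : Matrix (Fin 2) (Fin 2) ℂ) :
    R12 (cupCap εu εd) * R12 (cupCap εu εd) =
      (∑ α, ∑ β, εu α β * εd α β) • R12 (cupCap εu εd) := by
  ext ⟨i, j, k⟩ ⟨l, m, n⟩
  simp [R12, cupCap, Matrix.mul_apply, Fintype.sum_prod_type]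
  split_ifs <;> ring

theorem R23_cupCap_mul_self (εu εd : Matrix (Fin 2) (Fin 2) ℂ) :
    R23 (cupCap εu εd) * R23 (cupCap εu εd) =
      (∑ α, ∑ β, εu α β * εd α β) • R23 (cupCap εu εd) := by
  ext ⟨i, j, k⟩ ⟨l, m, n⟩
  simp [R23, cupCap, Matrix.mul_apply, Fintype.sum_prod_type]
  split_ifs <;> ring

theorem R12_mul_R23_cupCap {εu εd : Matrix (Fin 2) (Fin 2) ℂ} (h : εd * εu = 1)
    (p q : Fin 2 × Fin 2 × Fin 2) :
    (R12 (cupCap εu εd) * R23 (cupCap εu εd)) p q =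
      εu p.1 p.2.1 * (1 : Matrix _ _ ℂ) q.1 p.2.2 * εd q.2.1 q.2.2 := by
  rw [← h]
  simp [R12, R23, cupCap, Matrix.mul_apply, Fintype.sum_prod_type]
  ring

theorem R23_mul_R12_cupCap {εu εd : Matrix (Fin 2) (Fin 2) ℂ} (h : εu * εd = 1)
    (p q : Fin 2 × Fin 2 × Fin 2) :
    (R23 (cupCap εu εd) * R12 (cupCap εu εd)) p q =
      εu p.2.1 p.2.2 * (1 : Matrix _ _ ℂ) p.1 q.2.2 * εd q.1 q.2.1 := by
  rw [← h]
  simp [R12, R23, cupCap, Matrix.mul_apply, Fintype.sum_prod_type]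
  ring

theorem R12_mul_R23_mul_R12_cupCap {εu εd : Matrix (Fin 2) (Fin 2) ℂ}
    (hud : εu * εd = 1) (hdu : εd * εu = 1) :
    R12 (cupCap εu εd) * R23 (cupCap εu εd) * R12 (cupCap εu εd) = R12 (cupCap εu εd) := by
  ext ⟨i, j, k⟩ ⟨l, m, n⟩
  rw [Matrix.mul_apply]
  simp only [R12_mul_R23_cupCap hdu]
  have h : ∑ x, εu k x * εd x n = if k = n then 1 else 0 := by
    rw [← Matrix.mul_apply, hud, Matrix.one_apply]
  simp [R12, cupCap, Fintype.sum_prod_type, Matrix.one_apply] at h ⊢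
  split_ifs at h ⊢ <;> linear_combination (εu i j * εd l m) * h

theorem R23_mul_R12_mul_R23_cupCap {εu εd : Matrix (Fin 2) (Fin 2) ℂ}
    (hud : εu * εd = 1) (hdu : εd * εu = 1) :
    R23 (cupCap εu εd) * R12 (cupCap εu εd) * R23 (cupCap εu εd) = R23 (cupCap εu εd) := by
  ext ⟨i, j, k⟩ ⟨l, m, n⟩
  rw [Matrix.mul_apply]
  simp only [R23_mul_R12_cupCap hud]
  have h : ∑ x, εd l x * εu x i = if i = l then 1 else 0 := by
    rw [← Matrix.mul_apply, hdu, Matrix.one_apply]; simp only [eq_comm]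
  simp [R23, cupCap, Fintype.sum_prod_type, Matrix.one_apply] at h ⊢
  split_ifs at h ⊢ <;> linear_combination (εu j k * εd m n) * h

/-- each of `R̂^+` (coefficient `a`) and `R̂^-` (coefficient `a⁻¹`)
satisfies the braid form of the Yang–Baxter equation:
`(R̂ ⊗ id)(id ⊗ R̂)(R̂ ⊗ id) = (id ⊗ R̂)(R̂ ⊗ id)(id ⊗ R̂)`. -/
theorem R_yang_baxter
    (εu εd : Matrix (Fin 2) (Fin 2) ℂ)
    (h1 : ∀ α β : Fin 2, ∑ γ, εu α γ * εd γ β = if α = β then 1 else 0)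
    (h2 : ∀ α β : Fin 2, ∑ γ, εd β γ * εu γ α = if α = β then 1 else 0)
    (a : ℂ) (ha : a ≠ 0)
    (hQ : a + a⁻¹ + ∑ α, ∑ β, εu α β * εd α β = 0) :
    ∀ c : ℂ, (c = a ∨ c = a⁻¹) →
      R12 (Rhat εu εd c) * R23 (Rhat εu εd c) * R12 (Rhat εu εd c) =
        R23 (Rhat εu εd c) * R12 (Rhat εu εd c) * R23 (Rhat εu εd c) := by
  intro c hc
  have hud : εu * εd = 1 := by
    ext α β
    rw [Matrix.mul_apply, h1, Matrix.one_apply]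
  have hdu : εd * εu = 1 := mul_eq_one_comm.mp hud
  have hloop : 1 + c * (∑ α, ∑ β, εu α β * εd α β) + c * c = 0 := by
    have hinv : a * a⁻¹ = 1 := mul_inv_cancel₀ ha
    rcases hc with rfl | rfl
    · linear_combination c * hQ - hinv
    · linear_combination a⁻¹ * hQ - hinv
  rw [R12_Rhat, R23_Rhat]
  exact braid_of_temperleyLieb (R12_cupCap_mul_self εu εd) (R23_cupCap_mul_self εu εd)
    (R12_mul_R23_mul_R12_cupCap hud hdu) (R23_mul_R12_mul_R23_cupCap hud hdu) hloop
end

section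
/- The R-matrices satisfy the Hecke relations: as operators on ℂ²⊗ℂ², (R̂^+ + a² · id)(R̂^+ − id) = 0 and (R̂^- + a^{-2} · id)(R̂^- − id) = 0. -/
/-- `R̂` is a rank-one perturbation of the identity. -/
lemma Rhat_eq_one_add (εu εd : Matrix (Fin 2) (Fin 2) ℂ) (c : ℂ) :
    Rhat εu εd c =
      1 + c • Matrix.vecMulVec (fun p : Fin 2 × Fin 2 => εu p.1 p.2)
        (fun q : Fin 2 × Fin 2 => εd q.1 q.2) := by
  ext ⟨α, β⟩ ⟨γ, δ⟩
  simp [Rhat, RmatA, Matrix.one_apply, Matrix.vecMulVec_apply, ← ite_and, mul_assoc,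
    and_comm]

/-- The Hecke relation for `R̂` at a parameter `c` with `c + c⁻¹ + ε^{αβ} ε_{αβ} = 0`. -/
lemma Rhat_hecke (εu εd : Matrix (Fin 2) (Fin 2) ℂ) {c : ℂ} (hc : c ≠ 0)
    (hQ : c + c⁻¹ + ∑ α, ∑ β, εu α β * εd α β = 0) :
    (Rhat εu εd c + c ^ 2 • (1 : Matrix (Fin 2 × Fin 2) (Fin 2 × Fin 2) ℂ)) *
        (Rhat εu εd c - 1) = 0 := by
  set K := Matrix.vecMulVec (fun p : Fin 2 × Fin 2 => εu p.1 p.2)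
    (fun q : Fin 2 × Fin 2 => εd q.1 q.2) with hK
  have hKK : K * K = (∑ α, ∑ β, εu α β * εd α β) • K := by
    ext p q
    simp only [hK, Matrix.mul_apply, Matrix.vecMulVec_apply, Matrix.smul_apply, smul_eq_mul,
      Fintype.sum_prod_type, Finset.sum_mul]
    refine Finset.sum_congr rfl fun _ _ => Finset.sum_congr rfl fun _ _ => by ring
  have hsum : 1 + c * (∑ α, ∑ β, εu α β * εd α β) + c ^ 2 = 0 := by
    linear_combination c * hQ - mul_inv_cancel₀ hc
  rw [Rhat_eq_one_add, ← hK, add_sub_cancel_left]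
  simp only [add_mul, one_mul, smul_mul_assoc, mul_smul_comm, hKK]
  generalize (∑ α, ∑ β, εu α β * εd α β) = Q at hsum
  match_scalars
  linear_combination c * hsum

/-- the Hecke relations
`(R̂^+ + a²·id)(R̂^+ − id) = 0` and `(R̂^- + a^{-2}·id)(R̂^- − id) = 0`. -/
theorem R_hecke
    (εu εd : Matrix (Fin 2) (Fin 2) ℂ)
    (h1 : ∀ α β : Fin 2, ∑ γ, εu α γ * εd γ β = if α = β then 1 else 0)
    (h2 : ∀ α β : Fin 2, ∑ γ, εd β γ * εu γ α = if α = β then 1 else 0)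
    (a : ℂ) (ha : a ≠ 0)
    (hQ : a + a⁻¹ + ∑ α, ∑ β, εu α β * εd α β = 0) :
    (Rhat εu εd a + a ^ 2 • (1 : Matrix (Fin 2 × Fin 2) (Fin 2 × Fin 2) ℂ)) *
        (Rhat εu εd a - 1) = 0 ∧
    (Rhat εu εd a⁻¹ + (a⁻¹) ^ 2 • (1 : Matrix (Fin 2 × Fin 2) (Fin 2 × Fin 2) ℂ)) *
        (Rhat εu εd a⁻¹ - 1) = 0 := by
  refine ⟨Rhat_hecke εu εd ha hQ, Rhat_hecke εu εd (inv_ne_zero ha) ?_⟩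
  rwa [inv_inv, add_comm a⁻¹ a]
end

section
/- The R-matrices are compatible with the spinor metric: for all σ,γ,δ,ρ ∈ {1,2}, Σ_{α,β,λ} ε_{αβ} R^{±αλ}_{σγ} R^{±βρ}_{λδ} = a^{±1} ε_{γδ} δ^ρ_σ (under the index conventions fixed here). -/
/-- compatibility of the R-matrices with the spinor metric:
`Σ_{α,β,λ} ε_{αβ} R^{±αλ}_{σγ} R^{±βρ}_{λδ} = a^{±1} ε_{γδ} δ^ρ_σ`
(for `R^+` the coefficient is `a`, for `R^-` it is `a⁻¹`). -/
theorem R_metric_compat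
    (εu εd : Matrix (Fin 2) (Fin 2) ℂ)
    (h1 : ∀ α β : Fin 2, ∑ γ, εu α γ * εd γ β = if α = β then 1 else 0)
    (h2 : ∀ α β : Fin 2, ∑ γ, εd β γ * εu γ α = if α = β then 1 else 0)
    (a : ℂ) (ha : a ≠ 0)
    (hQ : a + a⁻¹ + ∑ α, ∑ β, εu α β * εd α β = 0) :
    ∀ c : ℂ, (c = a ∨ c = a⁻¹) →
      ∀ σ γ δ ρ : Fin 2,
        ∑ α, ∑ β, ∑ l, εd α β * RmatA εu εd c α l σ γ * RmatA εu εd c β ρ l δ =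
          c * εd γ δ * (if σ = ρ then 1 else 0) := by
  intro c hc σ γ δ ρ
  have hquad : 1 + c * (∑ α, ∑ β, εu α β * εd α β) + c ^ 2 = 0 := by
    have ha' : a * a⁻¹ = 1 := mul_inv_cancel₀ ha
    rcases hc with rfl | rfl
    · linear_combination c * hQ - ha'
    · linear_combination a⁻¹ * hQ - ha'
  have e1 := h1 ρ δ
  have e2 := h2 ρ σ
  have e3 := h2 ρ 0
  have e4 := h2 ρ 1
  simp only [RmatA, Fin.sum_univ_two] at *
  linear_combination (norm := skip) εd σ γ * (if ρ = δ then 1 else 0) * hquad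
    + c * εd γ δ * e2 + c ^ 2 * εd σ γ * (εu 0 0 * εd 0 δ + εu 0 1 * εd 1 δ) * e3
    + c ^ 2 * εd σ γ * (εu 1 0 * εd 0 δ + εu 1 1 * εd 1 δ) * e4 + c ^ 2 * εd σ γ * e1
  clear * -
  fin_cases σ <;> fin_cases γ <;> fin_cases δ <;> fin_cases ρ <;> simp <;> ring
end

section
/- The following quadruple R-matrix contraction identities hold for each sign choice: Σ (over α,κ,τ,σ,μ,ν,δ,ξ) R^{∓ακ}_{τσ} R^{∓μβ}_{κν} R^{±ρξ}_{δα} R^{±λγ}_{ξμ} ε^{δν} ε^{τσ} = ε^{ρβ} ε^{λγ}, and Σ (over the same indices) R^{∓ακ}_{τσ} R^{∓μβ}_{κν} R^{±ρξ}_{δα} R^{±λγ}_{ξμ} ε^{δτ} ε^{σν} = ε^{ρλ} ε^{γβ}, where ρ, β, λ, γ are free. -/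
/-- The action of `R` on a tensor with two upper indices. -/
theorem RmatA_contract (εu εd : Matrix (Fin 2) (Fin 2) ℂ) (c : ℂ) (X : Fin 2 → Fin 2 → ℂ)
    (α β : Fin 2) :
    ∑ γ, ∑ δ, RmatA εu εd c α β γ δ * X γ δ =
      X α β + c * εu α β * ∑ γ, ∑ δ, εd γ δ * X γ δ := by
  simp only [RmatA, add_mul, Finset.sum_add_distrib, Finset.mul_sum]
  congr 1
  · simp
  · simp only [mul_assoc]

/-- `ε^{αβ}` is an eigenvector of `R`, with eigenvalue `-c²`. -/
theorem RmatA_contract_metric {εu εd : Matrix (Fin 2) (Fin 2) ℂ} {c c' : ℂ} (hcc : c * c' = 1)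
    (hQ : c + c' + ∑ α, ∑ β, εu α β * εd α β = 0) (α β : Fin 2) :
    ∑ γ, ∑ δ, RmatA εu εd c α β γ δ * εu γ δ = -c ^ 2 * εu α β := by
  rw [RmatA_contract εu εd c (fun γ δ => εu γ δ)]
  simp only [mul_comm (εd _ _)]
  linear_combination c * εu α β * hQ - εu α β * hcc

section Metric

variable {εu εd : Matrix (Fin 2) (Fin 2) ℂ}

theorem metric_contract_fst_snd
    (h1 : ∀ α β : Fin 2, ∑ γ, εu α γ * εd γ β = if α = β then 1 else 0) (α β : Fin 2) :
    ∑ γ, ∑ δ, εd γ δ * (εu α γ * εu δ β) = εu α β := by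
  have h : ∀ δ, ∑ γ, εd γ δ * (εu α γ * εu δ β) = (if α = δ then 1 else 0) * εu δ β := by
    intro δ
    rw [← h1, Finset.sum_mul]
    exact Finset.sum_congr rfl fun γ _ => by ring
  rw [Finset.sum_comm]
  simp [h]

theorem metric_contract_snd_snd
    (h1 : ∀ α β : Fin 2, ∑ γ, εu α γ * εd γ β = if α = β then 1 else 0) (α β : Fin 2) :
    ∑ γ, ∑ δ, εd γ δ * (εu α γ * εu β δ) = εu β α := by
  have h : ∀ δ, ∑ γ, εd γ δ * (εu α γ * εu β δ) = (if α = δ then 1 else 0) * εu β δ := by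
    intro δ
    rw [← h1, Finset.sum_mul]
    exact Finset.sum_congr rfl fun γ _ => by ring
  rw [Finset.sum_comm]
  simp [h]

theorem metric_contract_fst_fst
    (h2 : ∀ α β : Fin 2, ∑ γ, εd β γ * εu γ α = if α = β then 1 else 0) (α β : Fin 2) :
    ∑ γ, ∑ δ, εd γ δ * (εu δ α * εu γ β) = εu α β := by
  have h : ∀ γ, ∑ δ, εd γ δ * (εu δ α * εu γ β) = (if α = γ then 1 else 0) * εu γ β := by
    intro γ
    rw [← h2, Finset.sum_mul]
    exact Finset.sum_congr rfl fun δ _ => by ring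
  simp [h]

/-- Contracting the lower left index of `R` with a metric. -/
theorem RmatA_contract_left
    (h1 : ∀ α β : Fin 2, ∑ γ, εu α γ * εd γ β = if α = β then 1 else 0) (c : ℂ)
    (α β γ δ : Fin 2) :
    ∑ τ, εu α τ * RmatA εu εd c β γ τ δ =
      εu α β * (if γ = δ then 1 else 0) + c * εu β γ * (if α = δ then 1 else 0) := by
  rw [← h1 α δ, Finset.mul_sum]
  simp only [RmatA, mul_add, Finset.sum_add_distrib]
  congr 1
  · simp
  · exact Finset.sum_congr rfl fun τ _ => by ring

theorem RmatA_contract_left_right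
    (h1 : ∀ α β : Fin 2, ∑ γ, εu α γ * εd γ β = if α = β then 1 else 0) (c : ℂ)
    (α β γ : Fin 2) (f : Fin 2 → ℂ) :
    ∑ δ, (∑ τ, εu α τ * RmatA εu εd c β γ τ δ) * f δ =
      εu α β * f γ + c * εu β γ * f α := by
  simp [RmatA_contract_left h1, add_mul, Finset.sum_add_distrib]

end Metric

/-- The first contraction identity, with the coefficients of the two kinds of `R`-matrices
entering symmetrically. -/
theorem RmatA_quadruple_fst {εu εd : Matrix (Fin 2) (Fin 2) ℂ}
    (h1 : ∀ α β : Fin 2, ∑ γ, εu α γ * εd γ β = if α = β then 1 else 0)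
    (h2 : ∀ α β : Fin 2, ∑ γ, εd β γ * εu γ α = if α = β then 1 else 0)
    {c c' : ℂ} (hcc : c * c' = 1) (hQ : c + c' + ∑ α, ∑ β, εu α β * εd α β = 0)
    (ρ β l γ : Fin 2) :
    ∑ α, ∑ κ, ∑ τ, ∑ σ, ∑ μ, ∑ ν, ∑ δ, ∑ ξ,
      RmatA εu εd c' α κ τ σ * RmatA εu εd c' μ β κ ν *
        RmatA εu εd c ρ ξ δ α * RmatA εu εd c l γ ξ μ * εu δ ν * εu τ σ = εu ρ β * εu l γ := by
  have hmetric' := RmatA_contract_metric (c := c') (c' := c) (by rw [mul_comm, hcc])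
    (by rw [add_comm c', hQ])
  have hmetric := RmatA_contract_metric hcc hQ
  have hslide : ∀ ξ μ, ∑ δ, ∑ α, RmatA εu εd c ρ ξ δ α *
      (∑ ν, (∑ κ, εu α κ * RmatA εu εd c' μ β κ ν) * εu δ ν) = εu ρ β * εu ξ μ := by
    intro ξ μ
    simp only [RmatA_contract_left_right h1, mul_add, Finset.sum_add_distrib]
    rw [RmatA_contract εu εd c (fun δ α => εu α μ * εu δ β), metric_contract_fst_fst h2]
    have h : ∑ δ, ∑ α, RmatA εu εd c ρ ξ δ α * (c' * εu μ β * εu δ α) =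
        c' * εu μ β * (-c ^ 2 * εu ρ ξ) := by
      simp only [← hmetric, Finset.mul_sum]
      exact Finset.sum_congr rfl fun δ _ => Finset.sum_congr rfl fun α _ => by ring
    rw [h]
    linear_combination (-c * εu μ β * εu ρ ξ) * hcc
  calc
    _ = ∑ ξ, ∑ μ, RmatA εu εd c l γ ξ μ * ∑ δ, ∑ α, RmatA εu εd c ρ ξ δ α *
          (∑ ν, (∑ κ, (∑ τ, ∑ σ, RmatA εu εd c' α κ τ σ * εu τ σ) *
            RmatA εu εd c' μ β κ ν) * εu δ ν) := by
      simp only [Fin.sum_univ_two]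
      ring
    _ = -c' ^ 2 * ∑ ξ, ∑ μ, RmatA εu εd c l γ ξ μ * ∑ δ, ∑ α, RmatA εu εd c ρ ξ δ α *
          (∑ ν, (∑ κ, εu α κ * RmatA εu εd c' μ β κ ν) * εu δ ν) := by
      simp only [hmetric', Finset.mul_sum, Finset.sum_mul]
      congr! 6
      ring
    _ = -c' ^ 2 * (εu ρ β * ∑ ξ, ∑ μ, RmatA εu εd c l γ ξ μ * εu ξ μ) := by
      simp only [hslide]
      simp only [Finset.mul_sum]
      congr! 2
      ring
    _ = εu ρ β * εu l γ := by
      rw [hmetric]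
      linear_combination (c * c' + 1) * εu ρ β * εu l γ * hcc

/-- The second contraction identity, with the coefficients of the two kinds of `R`-matrices
entering symmetrically. -/
theorem RmatA_quadruple_snd {εu εd : Matrix (Fin 2) (Fin 2) ℂ}
    (h1 : ∀ α β : Fin 2, ∑ γ, εu α γ * εd γ β = if α = β then 1 else 0)
    (h2 : ∀ α β : Fin 2, ∑ γ, εd β γ * εu γ α = if α = β then 1 else 0)
    {c c' : ℂ} (hcc : c * c' = 1) (hQ : c + c' + ∑ α, ∑ β, εu α β * εd α β = 0)
    (ρ β l γ : Fin 2) :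
    ∑ α, ∑ κ, ∑ τ, ∑ σ, ∑ μ, ∑ ν, ∑ δ, ∑ ξ,
      RmatA εu εd c' α κ τ σ * RmatA εu εd c' μ β κ ν *
        RmatA εu εd c ρ ξ δ α * RmatA εu εd c l γ ξ μ * εu δ τ * εu σ ν = εu ρ l * εu γ β := by
  have hmetric' := RmatA_contract_metric (c := c') (c' := c) (by rw [mul_comm, hcc])
    (by rw [add_comm c', hQ])
  have hmetric := RmatA_contract_metric hcc hQ
  have hinner : ∀ μ δ α, ∑ κ, ∑ ν, RmatA εu εd c' μ β κ ν *
      (∑ σ, (∑ τ, εu δ τ * RmatA εu εd c' α κ τ σ) * εu σ ν) =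
        c' * (εu α μ * εu δ β) := by
    intro μ δ α
    have h := RmatA_contract εu εd c' (fun κ ν => εu α κ * εu δ ν) μ β
    rw [metric_contract_snd_snd h1] at h
    calc
      _ = εu δ α * (∑ κ, ∑ ν, RmatA εu εd c' μ β κ ν * εu κ ν) +
          c' * ∑ κ, ∑ ν, RmatA εu εd c' μ β κ ν * (εu α κ * εu δ ν) := by
        simp only [RmatA_contract_left_right h1 c' δ α _ (fun σ => εu σ _), Finset.mul_sum,
          ← Finset.sum_add_distrib]
        congr! 2
        ring
      _ = _ := by
        rw [h, hmetric']
        ring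
  have houter : ∀ ξ μ, ∑ δ, ∑ α, RmatA εu εd c ρ ξ δ α * (c' * (εu α μ * εu δ β)) =
      c' * (εu ρ β * εu ξ μ) + εu ρ ξ * εu μ β := by
    intro ξ μ
    have h := RmatA_contract εu εd c (fun δ α => εu α μ * εu δ β) ρ ξ
    rw [metric_contract_fst_fst h2] at h
    simp only [mul_left_comm _ c', ← Finset.mul_sum]
    rw [h]
    linear_combination εu ρ ξ * εu μ β * hcc
  calc
    _ = ∑ ξ, ∑ μ, RmatA εu εd c l γ ξ μ * ∑ δ, ∑ α, RmatA εu εd c ρ ξ δ α *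
          ∑ κ, ∑ ν, RmatA εu εd c' μ β κ ν *
            (∑ σ, (∑ τ, εu δ τ * RmatA εu εd c' α κ τ σ) * εu σ ν) := by
      simp only [Fin.sum_univ_two]
      ring
    _ = c' * εu ρ β * (∑ ξ, ∑ μ, RmatA εu εd c l γ ξ μ * εu ξ μ) +
          ∑ ξ, ∑ μ, RmatA εu εd c l γ ξ μ * (εu ρ ξ * εu μ β) := by
      simp only [hinner, houter]
      simp only [Finset.mul_sum, ← Finset.sum_add_distrib]
      congr! 2
      ring
    _ = εu ρ l * εu γ β := by
      rw [hmetric, RmatA_contract εu εd c (fun ξ μ => εu ρ ξ * εu μ β),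
        metric_contract_fst_snd h1]
      linear_combination (-c * εu ρ β * εu l γ) * hcc

/-- the quadruple R-matrix contraction identities.  For each sign
choice (`cM` is the coefficient of `R^∓`, `cP` that of `R^±`):
`Σ R^{∓ακ}_{τσ} R^{∓μβ}_{κν} R^{±ρξ}_{δα} R^{±λγ}_{ξμ} ε^{δν} ε^{τσ} = ε^{ρβ} ε^{λγ}` and
`Σ R^{∓ακ}_{τσ} R^{∓μβ}_{κν} R^{±ρξ}_{δα} R^{±λγ}_{ξμ} ε^{δτ} ε^{σν} = ε^{ρλ} ε^{γβ}`,
with `ρ, β, λ, γ` free and the sums over `α,κ,τ,σ,μ,ν,δ,ξ`. -/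
theorem R_quadruple_contractions
    (εu εd : Matrix (Fin 2) (Fin 2) ℂ)
    (h1 : ∀ α β : Fin 2, ∑ γ, εu α γ * εd γ β = if α = β then 1 else 0)
    (h2 : ∀ α β : Fin 2, ∑ γ, εd β γ * εu γ α = if α = β then 1 else 0)
    (a : ℂ) (ha : a ≠ 0)
    (hQ : a + a⁻¹ + ∑ α, ∑ β, εu α β * εd α β = 0) :
    ∀ cP cM : ℂ, ((cP = a ∧ cM = a⁻¹) ∨ (cP = a⁻¹ ∧ cM = a)) →
      ∀ ρ β l γ : Fin 2,
        (∑ α, ∑ κ, ∑ τ, ∑ σ, ∑ μ, ∑ ν, ∑ δ, ∑ ξ,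
            RmatA εu εd cM α κ τ σ * RmatA εu εd cM μ β κ ν *
              RmatA εu εd cP ρ ξ δ α * RmatA εu εd cP l γ ξ μ *
                εu δ ν * εu τ σ = εu ρ β * εu l γ) ∧
        (∑ α, ∑ κ, ∑ τ, ∑ σ, ∑ μ, ∑ ν, ∑ δ, ∑ ξ,
            RmatA εu εd cM α κ τ σ * RmatA εu εd cM μ β κ ν *
              RmatA εu εd cP ρ ξ δ α * RmatA εu εd cP l γ ξ μ *
                εu δ τ * εu σ ν = εu ρ l * εu γ β) := by
  rintro cP cM (⟨rfl, rfl⟩ | ⟨rfl, rfl⟩) ρ β l γ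
  · have hcc := mul_inv_cancel₀ ha
    exact ⟨RmatA_quadruple_fst h1 h2 hcc hQ ρ β l γ, RmatA_quadruple_snd h1 h2 hcc hQ ρ β l γ⟩
  · have hcc := inv_mul_cancel₀ ha
    rw [add_comm cM] at hQ
    exact ⟨RmatA_quadruple_fst h1 h2 hcc hQ ρ β l γ, RmatA_quadruple_snd h1 h2 hcc hQ ρ β l γ⟩
end

section
/- For any two 2×2 complex matrices σ^I and σ^J, the quantum metric pairing G_±^{IJ} := (1/Q) Σ ε^{αν} σ^I_{αβ̇} σ̄_±^{Jβ̇γ} ε_{γν} satisfies both alternative expressions: G_±^{IJ} = (1/Q) Σ ε_{ν̇γ̇} σ̄_±^{Iγ̇α} σ^J_{αβ̇} ε^{ν̇β̇}, and the closed formula G_±^{IJ} = (1/Q)( a^{±1/2} Σ_{ξ,μ} σ^{Iξ}_{μ̇} σ^{J ξ̇}_{μ} − a^{∓1/2} (Σ_ξ σ^{Iξξ̇})(Σ_δ σ^{Jδδ̇}) ), where σ^{Iα}_{β̇} := Σ_ρ σ^I_{ρβ̇} ε^{ρα}, σ^{I β̇}_{α} := Σ_ρ ε^{β̇ρ̇}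 σ^I_{αρ̇}, and σ^{Iαβ̇} := Σ_{γ,ρ} ε^{γα} ε^{β̇ρ̇} σ^I_{γρ̇}, with dotted and undotted indices of the same letter identified numerically. -/
noncomputable section

open scoped Matrix

/-- Lower undotted spinor metric `ε_{αβ}` of the two-parameter deformation. -/
def epsLo (q r : ℝ) : Matrix (Fin 2) (Fin 2) ℂ :=
  ((Real.sqrt (1 - r ^ 2) : ℂ))⁻¹ •
    !![Complex.I * (r : ℂ), -((Real.sqrt q : ℂ))⁻¹; (Real.sqrt q : ℂ), Complex.I * (r : ℂ)]

/-- Upper undotted spinor metric `ε^{αβ}`. -/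
def epsUp (q r : ℝ) : Matrix (Fin 2) (Fin 2) ℂ :=
  ((Real.sqrt (1 - r ^ 2) : ℂ))⁻¹ •
    !![Complex.I * (r : ℂ), ((Real.sqrt q : ℂ))⁻¹; -(Real.sqrt q : ℂ), Complex.I * (r : ℂ)]

/-- Lower dotted spinor metric `ε_{α̇β̇}`. -/
def epsLoD (q r : ℝ) : Matrix (Fin 2) (Fin 2) ℂ :=
  ((Real.sqrt (1 - r ^ 2) : ℂ))⁻¹ •
    !![-(Complex.I * (r : ℂ)), (Real.sqrt q : ℂ); -((Real.sqrt q : ℂ))⁻¹, -(Complex.I * (r : ℂ))]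

/-- Upper dotted spinor metric `ε^{α̇β̇}`. -/
def epsUpD (q r : ℝ) : Matrix (Fin 2) (Fin 2) ℂ :=
  ((Real.sqrt (1 - r ^ 2) : ℂ))⁻¹ •
    !![-(Complex.I * (r : ℂ)), -(Real.sqrt q : ℂ); ((Real.sqrt q : ℂ))⁻¹, -(Complex.I * (r : ℂ))]

/-- `Q = (2r + q + q⁻¹)/(1 − r²)`. -/
def Qval (q r : ℝ) : ℝ := (2 * r + q + q⁻¹) / (1 - r ^ 2)

/-- The R-matrix `R^{αβ}_{γδ} = δ^α_γ δ^β_δ + c · ε^{αβ} ε_{γδ}` (with `c = a^{±1}`). -/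
def Rm (q r : ℝ) (c : ℂ) (α β γ δ : Fin 2) : ℂ :=
  (if α = γ then 1 else 0) * (if β = δ then 1 else 0) + c * epsUp q r α β * epsLo q r γ δ

/-- The conjugate `σ̄_±^{α̇β} = a^{±1/2} Σ ε^{α̇λ̇} ε_{ρκ} R^{∓σκ}_{μν} ε^{μλ} ε^{νβ} σ_{σρ̇}`
of a 2×2 matrix `σ`; `s = true` is the `+` sign, `s = false` the `−` sign. -/
def sbar (q r a : ℝ) (s : Bool) (σ : Matrix (Fin 2) (Fin 2) ℂ) (ad b : Fin 2) : ℂ :=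
  (if s then (Real.sqrt a : ℂ) else ((Real.sqrt a : ℂ))⁻¹) *
    ∑ l, ∑ sg, ∑ rh, ∑ ka, ∑ mu, ∑ nu,
      epsUpD q r ad l * epsLo q r rh ka * Rm q r (if s then ((a : ℂ))⁻¹ else (a : ℂ)) sg ka mu nu *
        epsUp q r mu l * epsUp q r nu b * σ sg rh

/-- The quantum Pauli matrices `σ^0, σ^1, σ^2, σ^3`. -/
def pauli : Fin 4 → Matrix (Fin 2) (Fin 2) ℂ :=
  ![!![1, 0; 0, 1], !![0, 1; 1, 0], !![0, -Complex.I; Complex.I, 0], !![1, 0; 0, -1]]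

/-- The metric pairing `G_±^{IJ} = (1/Q) Σ ε^{αν} σ^I_{αβ̇} σ̄_±^{Jβ̇γ} ε_{γν}`. -/
def Gpair (q r a : ℝ) (s : Bool) (σI σJ : Matrix (Fin 2) (Fin 2) ℂ) : ℂ :=
  (1 / (Qval q r : ℂ)) * ∑ al, ∑ nu, ∑ be, ∑ ga,
    epsUp q r al nu * σI al be * sbar q r a s σJ be ga * epsLo q r ga nu

/-- The quantum Minkowski metric `G_±^{IJ}` as a 4×4 matrix. -/
def GupM (q r a : ℝ) (s : Bool) : Matrix (Fin 4) (Fin 4) ℂ :=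
  fun I J => Gpair q r a s (pauli I) (pauli J)

/-- The inverse metric `G_{±IJ}`. -/
def GloM (q r a : ℝ) (s : Bool) : Matrix (Fin 4) (Fin 4) ℂ := (GupM q r a s)⁻¹

/-- The lowered conjugate Pauli matrices `σ̄_L^{α̇β} = Σ_N G_{+LN} σ̄_+^{Nα̇β}`. -/
def sbarL (q r a : ℝ) (L : Fin 4) (ad b : Fin 2) : ℂ :=
  ∑ N, GloM q r a true L N * sbar q r a true (pauli N) ad b

/-- The quantum Lorentz group generators
`Λ_L^K = (1/Q) Σ ε_{γ̇δ̇} σ̄_L^{δ̇α} M_α^σ σ^K_{σρ̇} M̄_β̇^{ρ̇} ε^{γ̇β̇}`. -/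
def Lor {A : Type*} [Ring A] [Algebra ℂ A] (q r a : ℝ)
    (M Mb : Fin 2 → Fin 2 → A) (L K : Fin 4) : A :=
  ∑ ga, ∑ de, ∑ al, ∑ sg, ∑ rh, ∑ be,
    ((1 / (Qval q r : ℂ)) * epsLoD q r ga de * sbarL q r a L de al * pauli K sg rh *
      epsUpD q r ga be) • (M al sg * Mb be rh)

/-- The Lorentz R-matrices
`𝓡^{±NM}_{LK} = (1/Q²) Σ R^{∓ακ}_{τσ} R^{∓μβ}_{κν} R^{±ρξ}_{δα} R^{±λγ}_{ξμ}
σ^{M β̇}_γ σ^{N λ̇}_ρ σ̄_{Lτ̇}^δ σ̄_{Kν̇}^σ`. -/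
def Rlor (q r a : ℝ) (s : Bool) (N M L K : Fin 4) : ℂ :=
  (1 / (Qval q r : ℂ) ^ 2) *
    ∑ al, ∑ be, ∑ ga, ∑ de, ∑ ka, ∑ l, ∑ mu, ∑ nu, ∑ xi, ∑ rh, ∑ sg, ∑ ta,
      Rm q r (if s then ((a : ℂ))⁻¹ else (a : ℂ)) al ka ta sg *
        Rm q r (if s then ((a : ℂ))⁻¹ else (a : ℂ)) mu be ka nu *
          Rm q r (if s then (a : ℂ) else ((a : ℂ))⁻¹) rh xi de al *
            Rm q r (if s then (a : ℂ) else ((a : ℂ))⁻¹) l ga xi mu *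
              (∑ p, epsUpD q r be p * pauli M ga p) *
                (∑ p, epsUpD q r l p * pauli N rh p) *
                  (∑ p, epsLoD q r ta p * sbarL q r a L p de) *
                    (∑ p, epsLoD q r nu p * sbarL q r a K p sg)

end

open Matrix

lemma epsUpD_eq (q r : ℝ) : epsUpD q r = -(epsLo q r)ᵀ := by
  ext i j; fin_cases i <;> fin_cases j <;> simp [epsUpD, epsLo]

lemma epsLoD_eq (q r : ℝ) : epsLoD q r = -(epsUp q r)ᵀ := by
  ext i j; fin_cases i <;> fin_cases j <;> simp [epsLoD, epsUp]

lemma epsLo_mul_epsUp {q r : ℝ} (hq : 0 < q) (hr : r ^ 2 < 1) :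
    epsLo q r * epsUp q r = 1 := by
  have hd : ((Real.sqrt (1 - r ^ 2) : ℂ)) ^ 2 = 1 - (r : ℂ) ^ 2 := by
    exact_mod_cast Real.sq_sqrt (by linarith : 0 ≤ 1 - r ^ 2)
  have hd0 : (Real.sqrt (1 - r ^ 2) : ℂ) ≠ 0 := by
    exact_mod_cast (Real.sqrt_pos.2 (by linarith)).ne'
  have hq0 : (Real.sqrt q : ℂ) ≠ 0 := by
    exact_mod_cast (Real.sqrt_pos.2 hq).ne'
  ext i j
  fin_cases i <;> fin_cases j <;> simp [epsLo, epsUp, Matrix.mul_apply, Fin.sum_univ_two] <;>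
    field_simp <;> grind [Complex.I_sq]

lemma epsUp_mul_epsLo {q r : ℝ} (hq : 0 < q) (hr : r ^ 2 < 1) :
    epsUp q r * epsLo q r = 1 :=
  mul_eq_one_comm.1 (epsLo_mul_epsUp hq hr)

/-- The deformed trace `∑ ε^{αν} σ_{αγ} ε_{γν}`. -/
noncomputable def epsTrace (q r : ℝ) (σ : Matrix (Fin 2) (Fin 2) ℂ) : ℂ :=
  ∑ i, ∑ j, (epsUp q r * (epsLo q r)ᵀ) i j * σ i j

/-- The scalar `a^{±1/2}` attached to a sign. -/
noncomputable def sqrtSign (a : ℝ) (s : Bool) : ℂ :=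
  if s then (Real.sqrt a : ℂ) else ((Real.sqrt a : ℂ))⁻¹

lemma sqrtSign_mul {a : ℝ} (ha : 0 < a) (s : Bool) :
    sqrtSign a s * (if s then ((a : ℂ))⁻¹ else (a : ℂ)) = (sqrtSign a s)⁻¹ := by
  have h0 : (Real.sqrt a : ℂ) ≠ 0 := by
    exact_mod_cast (Real.sqrt_pos.2 ha).ne'
  have h : (a : ℂ) = (Real.sqrt a : ℂ) ^ 2 := by
    exact_mod_cast (Real.sq_sqrt ha.le).symm
  cases s <;> simp only [sqrtSign, h, if_true, Bool.false_eq_true, if_false] <;> field_simp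

lemma sum_Rm (q r : ℝ) (c : ℂ) (D σ : Matrix (Fin 2) (Fin 2) ℂ) (ad b : Fin 2) :
    ∑ l, ∑ sg, ∑ rh, ∑ ka, ∑ mu, ∑ nu,
      D ad l * epsLo q r rh ka * Rm q r c sg ka mu nu *
        epsUp q r mu l * epsUp q r nu b * σ sg rh =
    ∑ sg, ∑ rh, ((epsUp q r * Dᵀ) sg ad * (epsLo q r * epsUp q r) rh b +
      c * (epsUp q r * (epsLo q r)ᵀ) sg rh *
        ((epsUp q r * Dᵀ)ᵀ * (epsLo q r * epsUp q r)) ad b) * σ sg rh := by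
  simp only [Rm, Matrix.mul_apply, Matrix.transpose_apply, Fin.sum_univ_two]
  simp
  ring

lemma sbar_eq {q r a : ℝ} (hq : 0 < q) (hr : r ^ 2 < 1) (ha : 0 < a) (s : Bool)
    (σ : Matrix (Fin 2) (Fin 2) ℂ) (ad b : Fin 2) :
    sbar q r a s σ ad b = -(sqrtSign a s * σ ad b +
      (sqrtSign a s)⁻¹ * epsTrace q r σ * (1 : Matrix (Fin 2) (Fin 2) ℂ) ad b) := by
  rw [sbar, sum_Rm, epsUpD_eq, ← sqrtSign_mul ha, epsTrace, ← sqrtSign]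
  simp only [transpose_neg, transpose_transpose, mul_neg, epsLo_mul_epsUp hq hr,
    epsUp_mul_epsLo hq hr, transpose_one, neg_mul, one_mul]
  generalize epsUp q r * (epsLo q r)ᵀ = K, (if s then ((a : ℂ))⁻¹ else (a : ℂ)) = c
  fin_cases ad <;> fin_cases b <;> simp [Fin.sum_univ_two, Matrix.one_apply] <;> ring

lemma Gpair_eq {q r a : ℝ} (hq : 0 < q) (hr : r ^ 2 < 1) (ha : 0 < a) (s : Bool)
    (σI σJ : Matrix (Fin 2) (Fin 2) ℂ) :
    Gpair q r a s σI σJ = (1 / (Qval q r : ℂ)) *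
      -(sqrtSign a s * epsTrace q r (σI * σJ) +
        (sqrtSign a s)⁻¹ * (epsTrace q r σI * epsTrace q r σJ)) := by
  rw [Gpair]
  simp only [sbar_eq hq hr ha]
  generalize epsTrace q r σJ = t
  congr 1
  simp [epsTrace, Matrix.mul_apply, Fin.sum_univ_two]
  ring

/-- for any two 2×2 matrices `σI, σJ`, the pairing
`G_±^{IJ} = (1/Q) Σ ε^{αν} σ^I_{αβ̇} σ̄_±^{Jβ̇γ} ε_{γν}` equals both the
alternative trace `(1/Q) Σ ε_{ν̇γ̇} σ̄_±^{Iγ̇α} σ^J_{αβ̇} ε^{ν̇β̇}` and the closed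
formula `(1/Q)(a^{±1/2} Σ σ^{Iξ}_{μ̇} σ^{J ξ̇}_{μ} − a^{∓1/2} (Σ σ^{Iξξ̇})(Σ σ^{Jδδ̇}))`. -/
theorem Gpair_alternative_expressions (q r : ℝ) (hq : 0 < q) (hr : r ^ 2 < 1)
    (a : ℝ) (ha : 0 < a) (haQ : a + a⁻¹ = Qval q r)
    (s : Bool) (σI σJ : Matrix (Fin 2) (Fin 2) ℂ) :
    Gpair q r a s σI σJ =
      (1 / (Qval q r : ℂ)) * ∑ nu, ∑ ga, ∑ al, ∑ be,
        epsLoD q r nu ga * sbar q r a s σI ga al * σJ al be * epsUpD q r nu be ∧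
    Gpair q r a s σI σJ =
      (1 / (Qval q r : ℂ)) *
        ((if s then (Real.sqrt a : ℂ) else ((Real.sqrt a : ℂ))⁻¹) *
            (∑ xi, ∑ mu, (∑ rh, σI rh mu * epsUp q r rh xi) *
              (∑ rh, epsUpD q r xi rh * σJ mu rh)) -
          (if s then ((Real.sqrt a : ℂ))⁻¹ else (Real.sqrt a : ℂ)) *
            ((∑ xi, ∑ ga, ∑ rh, epsUp q r ga xi * epsUpD q r xi rh * σI ga rh) *
              (∑ de, ∑ ga, ∑ rh, epsUp q r ga de * epsUpD q r de rh * σJ ga rh))) := by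
  have hsqrt : (if s then ((Real.sqrt a : ℂ))⁻¹ else (Real.sqrt a : ℂ)) = (sqrtSign a s)⁻¹ := by
    cases s <;> simp [sqrtSign]
  rw [Gpair_eq hq hr ha]
  constructor
  · simp only [sbar_eq hq hr ha, epsLoD_eq, epsUpD_eq]
    generalize epsTrace q r σI = t
    congr 1
    simp [epsTrace, Matrix.mul_apply, Fin.sum_univ_two]
    ring
  · rw [hsqrt, ← sqrtSign, epsUpD_eq]
    congr 1
    simp [epsTrace, Matrix.mul_apply, Fin.sum_univ_two]
    ring
end

section
/- For each sign choice and all free indices α, β, L, the identity Σ_{δ,γ,N} ε^{αδ} σ̄_±^{Nβ̇γ} ε_{γδ} G_{±NL} = Σ_{ν,μ} ε_{ν̇μ̇} σ̄_{(±)L}^{μ̇α} ε^{ν̇β̇} holds, where σ̄_{(±)L}^{μ̇α} := Σ_N G_{±LN} σ̄_±^{Nμ̇α}. (Consequently, the two expressions (29) and (30) of the paper define the same Lorentz generators.) -/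
namespace QuantumSpinor

open scoped Matrix

lemma sqrt_one_sub_sq_inv_mul_self {r : ℝ} (hr : r ^ 2 < 1) :
    ((Real.sqrt (1 - r ^ 2) : ℂ))⁻¹ * ((Real.sqrt (1 - r ^ 2) : ℂ))⁻¹ * (1 - (r : ℂ) ^ 2) = 1 := by
  have hpos : 0 < 1 - r ^ 2 := by linarith
  have hne : (Real.sqrt (1 - r ^ 2) : ℂ) ≠ 0 := by
    exact_mod_cast (Real.sqrt_pos.mpr hpos).ne'
  have hsq : (Real.sqrt (1 - r ^ 2) : ℂ) ^ 2 = 1 - (r : ℂ) ^ 2 := by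
    exact_mod_cast Real.sq_sqrt hpos.le
  rw [← hsq]
  field_simp

lemma epsLo_mul_epsUp {q r : ℝ} (hq : 0 < q) (hr : r ^ 2 < 1) : epsLo q r * epsUp q r = 1 := by
  have hs : (Real.sqrt q : ℂ) ≠ 0 := by exact_mod_cast (Real.sqrt_pos.mpr hq).ne'
  have hd := sqrt_one_sub_sq_inv_mul_self hr
  have hI := Complex.I_sq
  ext i j
  fin_cases i <;> fin_cases j <;>
    simp [epsLo, epsUp, Matrix.mul_apply, Fin.sum_univ_two] <;>
    grind

lemma epsUpD_eq (q r : ℝ) : epsUpD q r = -(epsLo q r)ᵀ := by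
  ext i j
  fin_cases i <;> fin_cases j <;> simp [epsLo, epsUpD]

lemma epsLoD_eq (q r : ℝ) : epsLoD q r = -(epsUp q r)ᵀ := by
  ext i j
  fin_cases i <;> fin_cases j <;> simp [epsUp, epsLoD]

/-- The twist `ε_{αγ} ε^{βγ}` entering the quantum trace. -/
noncomputable def twist (q r : ℝ) : Matrix (Fin 2) (Fin 2) ℂ := epsLo q r * (epsUp q r)ᵀ

lemma sum_delta_add_mul_eq (D L U σ : Matrix (Fin 2) (Fin 2) ℂ) (c : ℂ) (i j : Fin 2) :
    (∑ l, ∑ sg, ∑ rh, ∑ ka, ∑ mu, ∑ nu,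
      D i l * L rh ka * ((if sg = mu then 1 else 0) * (if ka = nu then 1 else 0)
        + c * U sg ka * L mu nu) * U mu l * U nu j * σ sg rh) =
      (D * Uᵀ * σ * (L * U) + (c * (σ * (L * Uᵀ)).trace) • (D * Uᵀ * (L * U))) i j := by
  simp [Matrix.mul_apply, Matrix.trace, Fin.sum_univ_two]
  ring

lemma sbar_eq {q r : ℝ} (hq : 0 < q) (hr : r ^ 2 < 1) (a : ℝ) (s : Bool)
    (σ : Matrix (Fin 2) (Fin 2) ℂ) :
    Matrix.of (sbar q r a s σ) = -(if s then (Real.sqrt a : ℂ) else ((Real.sqrt a : ℂ))⁻¹) •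
      (σ + ((if s then ((a : ℂ))⁻¹ else (a : ℂ)) * (σ * twist q r).trace) • 1) := by
  have hLU := epsLo_mul_epsUp hq hr
  have hDU : epsUpD q r * (epsUp q r)ᵀ = -1 := by
    rw [epsUpD_eq, neg_mul, ← Matrix.transpose_mul, mul_eq_one_comm.mp hLU, Matrix.transpose_one]
  ext i j
  rw [Matrix.of_apply]
  unfold sbar Rm
  rw [sum_delta_add_mul_eq, hLU, hDU]
  generalize (if s then (Real.sqrt a : ℂ) else ((Real.sqrt a : ℂ))⁻¹) = k
  generalize (if s then ((a : ℂ))⁻¹ else (a : ℂ)) = c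
  simp [twist]
  ring

/-- Symmetry of the metric: the lowered index may be contracted on either side. -/
lemma trace_mul_sbar_comm {q r : ℝ} (hq : 0 < q) (hr : r ^ 2 < 1) (a : ℝ) (s : Bool)
    (σ τ : Matrix (Fin 2) (Fin 2) ℂ) :
    (σ * (twist q r * Matrix.of (sbar q r a s τ))).trace =
      (τ * (Matrix.of (sbar q r a s σ) * twist q r)).trace := by
  rw [sbar_eq hq hr, sbar_eq hq hr]
  generalize (if s then (Real.sqrt a : ℂ) else ((Real.sqrt a : ℂ))⁻¹) = k
  generalize (if s then ((a : ℂ))⁻¹ else (a : ℂ)) = c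
  have hc : (σ * (twist q r * τ)).trace = (τ * (σ * twist q r)).trace := by
    rw [← mul_assoc, Matrix.trace_mul_comm]
  simp only [neg_smul, mul_neg, neg_mul, mul_add, add_mul, smul_add, Matrix.mul_smul,
    Matrix.smul_mul, mul_one, one_mul, Matrix.trace_neg, Matrix.trace_add, Matrix.trace_smul,
    smul_eq_mul, hc]
  ring

lemma Qval_mul_Gpair {q r : ℝ} (hQ : Qval q r ≠ 0) (a : ℝ) (s : Bool)
    (σ τ : Matrix (Fin 2) (Fin 2) ℂ) :
    (Qval q r : ℂ) * Gpair q r a s σ τ =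
      (σ * (Matrix.of (sbar q r a s τ) * twist q r)).trace := by
  have hQ' : (Qval q r : ℂ) ≠ 0 := by exact_mod_cast hQ
  rw [Gpair, ← mul_assoc, mul_one_div_cancel hQ', one_mul]
  simp only [Matrix.trace, Matrix.diag, Matrix.mul_apply, twist, Fin.sum_univ_two,
    Matrix.of_apply, Matrix.transpose_apply]
  ring

lemma eq_of_trace_pauli_mul_eq {X Y : Matrix (Fin 2) (Fin 2) ℂ}
    (h : ∀ I, (pauli I * X).trace = (pauli I * Y).trace) : X = Y := by
  simp only [Matrix.trace_fin_two, Matrix.mul_apply, Fin.sum_univ_two] at h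
  have h0 := h 0
  have h1 := h 1
  have h2 := h 2
  have h3 := h 3
  simp [pauli] at h0 h1 h2 h3
  have hI := Complex.I_sq
  ext i j
  fin_cases i <;> fin_cases j <;> simp <;> grind

end QuantumSpinor

/-- `Σ_{δ,γ,N} ε^{αδ} σ̄_±^{Nβ̇γ} ε_{γδ} G_{±NL} =
Σ_{ν,μ} ε_{ν̇μ̇} σ̄_{(±)L}^{μ̇α} ε^{ν̇β̇}` where `σ̄_{(±)L}^{μ̇α} = Σ_N G_{±LN} σ̄_±^{Nμ̇α}`
(so expressions (29) and (30) of the paper define the same Lorentz generators). -/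
theorem lorentz_generator_equivalence (q r : ℝ) (hq : 0 < q) (hr : r ^ 2 < 1)
    (a : ℝ) (ha : 0 < a) (haQ : a + a⁻¹ = Qval q r)
    (hG : ∀ s, IsUnit (GupM q r a s).det) :
    ∀ (s : Bool) (α β : Fin 2) (L : Fin 4),
      ∑ de, ∑ ga, ∑ N,
          epsUp q r α de * sbar q r a s (pauli N) β ga * epsLo q r ga de * GloM q r a s N L =
        ∑ nu, ∑ mu, epsLoD q r nu mu *
          (∑ N, GloM q r a s L N * sbar q r a s (pauli N) mu α) * epsUpD q r nu β := by
  intro s α β L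
  have hQ : Qval q r ≠ 0 := by rw [← haQ]; positivity
  have hlower :
      ∑ N, GloM q r a s N L • (Matrix.of (sbar q r a s (pauli N)) * QuantumSpinor.twist q r) =
      ∑ N, GloM q r a s L N • (QuantumSpinor.twist q r * Matrix.of (sbar q r a s (pauli N))) := by
    refine QuantumSpinor.eq_of_trace_pauli_mul_eq fun I => ?_
    have hmul_inv : (GupM q r a s * GloM q r a s) I L = (1 : Matrix (Fin 4) (Fin 4) ℂ) I L := by
      rw [GloM, Matrix.mul_nonsing_inv _ (hG s)]
    have hinv_mul : (GloM q r a s * GupM q r a s) L I = (1 : Matrix (Fin 4) (Fin 4) ℂ) L I := by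
      rw [GloM, Matrix.nonsing_inv_mul _ (hG s)]
    simp only [Finset.mul_sum, Matrix.trace_sum, Matrix.mul_smul, Matrix.trace_smul,
      QuantumSpinor.trace_mul_sbar_comm hq hr, ← QuantumSpinor.Qval_mul_Gpair hQ, smul_eq_mul]
    calc ∑ N, GloM q r a s N L * ((Qval q r : ℂ) * Gpair q r a s (pauli I) (pauli N))
        = (Qval q r : ℂ) * (GupM q r a s * GloM q r a s) I L := by
          rw [Matrix.mul_apply, Finset.mul_sum]
          exact Finset.sum_congr rfl fun N _ => by rw [GupM]; ring
      _ = (Qval q r : ℂ) * (GloM q r a s * GupM q r a s) L I := by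
          rw [hmul_inv, hinv_mul, Matrix.one_apply, Matrix.one_apply]
          simp only [eq_comm]
      _ = ∑ N, GloM q r a s L N * ((Qval q r : ℂ) * Gpair q r a s (pauli N) (pauli I)) := by
          rw [Matrix.mul_apply, Finset.mul_sum]
          exact Finset.sum_congr rfl fun N _ => by rw [GupM]; ring
  have hentry := congrFun (congrFun hlower β) α
  simp only [Matrix.sum_apply, Matrix.smul_apply, smul_eq_mul, Matrix.mul_apply,
    QuantumSpinor.twist, Matrix.of_apply, Matrix.transpose_apply, Fin.sum_univ_two, Fin.sum_univ_four] at hentry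
  simp only [QuantumSpinor.epsUpD_eq, QuantumSpinor.epsLoD_eq, Matrix.neg_apply,
    Matrix.transpose_apply, Fin.sum_univ_two, Fin.sum_univ_four]
  linear_combination hentry
end
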